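/- Let 0<q<1 and let α, β be real numbers with 2α≤1≤β. Then the function f_{α,β}(x;q) = Γ_q(x+β)·exp(−Li₂(1−q^x)/log q) / ((1−q^x)/(1−q))^{x+β−α} is logarithmically completely monotonic on (0,∞); that is, for every integer n≥1 and every x>0, (−1)^n (log f_{α,β}(·;q))^{(n)}(x) ≥ 0. -/

import Mathlib

/-- The `q`-gamma function for `0 < q < 1`:
`Γ_q(x) = (1−q)^(1−x) ∏_{j=0}^∞ (1−q^(j+1))/(1−q^(j+x))`. -/
noncomputable def qGamma (q x : ℝ) : ℝ :=
  (1 - q) ^ (1 - x) * ∏' j : ℕ, (1 - q ^ (j + 1)) / (1 - q ^ ((j : ℝ) + x))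

/-- The dilogarithm `Li₂(z) = −∫₀^z log(1−t)/t dt`. -/
noncomputable def dilog (z : ℝ) : ℝ := -∫ t in (0:ℝ)..z, Real.log (1 - t) / t

/-- The function `f_{α,β}(x;q) = Γ_q(x+β)·exp(−Li₂(1−q^x)/log q) / ((1−q^x)/(1−q))^(x+β−α)`. -/
noncomputable def qf (α β q x : ℝ) : ℝ :=
  qGamma q (x + β) * Real.exp (-dilog (1 - q ^ x) / Real.log q) /
    ((1 - q ^ x) / (1 - q)) ^ (x + β - α)

theorem two_sub_mul_exp_le {u : ℝ} (hu : 0 ≤ u) : (2 - u) * Real.exp u ≤ 2 + u := by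
  have hd : ∀ v : ℝ, HasDerivAt (fun v : ℝ => (2 + v) * Real.exp (-v) + v)
      (1 - (1 + v) * Real.exp (-v)) v := by
    intro v
    have h := (((hasDerivAt_id v).const_add 2).mul (hasDerivAt_neg v).exp).add (hasDerivAt_id v)
    refine h.congr_deriv ?_
    simp only [id]
    ring
  have hmono : MonotoneOn (fun v : ℝ => (2 + v) * Real.exp (-v) + v) (Set.Ici 0) := by
    refine monotoneOn_of_deriv_nonneg (convex_Ici 0)
      (fun v _ => (hd v).continuousAt.continuousWithinAt)
      (fun v _ => (hd v).differentiableAt.differentiableWithinAt) fun v _ => ?_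
    rw [(hd v).deriv, sub_nonneg, Real.exp_neg, ← div_eq_mul_inv, div_le_one (Real.exp_pos v)]
    linarith [Real.add_one_le_exp v]
  have h := hmono (Set.mem_Ici.2 le_rfl) (Set.mem_Ici.2 hu) hu
  simp only [neg_zero, Real.exp_zero] at h
  have h2 : 2 - u ≤ (2 + u) * Real.exp (-u) := by linarith
  rwa [Real.exp_neg, ← div_eq_mul_inv, le_div_iff₀ (Real.exp_pos u)] at h2

theorem one_le_mul_exp_div_add {u α β : ℝ} (hu : 0 < u) (hα : 2 * α ≤ 1) (hβ : 1 ≤ β) :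
    1 ≤ u * Real.exp (-(β * u)) / (1 - Real.exp (-u)) + (β - α) * u := by
  have hE : 1 + u ≤ Real.exp u := by linarith [Real.add_one_le_exp u]
  have hE0 : 0 < Real.exp u - 1 := by linarith
  have hw1 : u / (Real.exp u - 1) ≤ 1 := (div_le_one hE0).2 (by linarith)
  have hw2 : 1 - u / 2 ≤ u / (Real.exp u - 1) := by
    rw [le_div_iff₀ hE0]
    linarith [two_sub_mul_exp_le hu.le]
  have hw0 : 0 ≤ u / (Real.exp u - 1) := by positivity
  have hexp : 1 - (β - 1) * u ≤ Real.exp (-((β - 1) * u)) := by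
    linarith [Real.add_one_le_exp (-((β - 1) * u))]
  have heq : u * Real.exp (-(β * u)) / (1 - Real.exp (-u)) =
      Real.exp (-((β - 1) * u)) * (u / (Real.exp u - 1)) := by
    have hne : 1 - Real.exp (-u) ≠ 0 := by
      have : Real.exp (-u) < 1 := Real.exp_lt_one_iff.mpr (by linarith)
      linarith
    have hsplit : Real.exp (-(β * u)) = Real.exp (-((β - 1) * u)) * Real.exp (-u) := by
      rw [← Real.exp_add]; ring_nf
    have hinv : Real.exp u * Real.exp (-u) = 1 := by rw [← Real.exp_add]; simp
    rw [mul_div_assoc', div_eq_div_iff hne hE0.ne', hsplit]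
    linear_combination u * Real.exp (-((β - 1) * u)) * hinv
  rw [heq]
  have h1 := mul_le_mul_of_nonneg_right hexp hw0
  have h2 : 0 ≤ (β - 1) * u * (1 - u / (Real.exp u - 1)) :=
    mul_nonneg (mul_nonneg (by linarith) hu.le) (by linarith)
  nlinarith

theorem summable_succ_pow_mul_geometric {C z : ℝ} (hz0 : 0 ≤ z) (hz1 : z < 1) (m : ℕ) :
    Summable fun n : ℕ => C * ((n : ℝ) + 1) ^ m * z ^ (n + 1) := by
  have h := (summable_nat_add_iff 1).2 (summable_pow_mul_geometric_of_norm_lt_one (R := ℝ) m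
    (r := z) (by rwa [Real.norm_of_nonneg hz0]))
  refine (h.mul_left C).congr fun n => ?_
  push_cast
  ring

theorem summable_coeff_mul_geometric {c : ℕ → ℝ} {C z : ℝ} (hc : ∀ n, |c n| ≤ C)
    (hz0 : 0 ≤ z) (hz1 : z < 1) (m : ℕ) :
    Summable fun n : ℕ => c n * ((n : ℝ) + 1) ^ m * z ^ (n + 1) := by
  refine (summable_succ_pow_mul_geometric (C := C) hz0 hz1 m).of_norm_bounded fun n => ?_
  rw [norm_mul, norm_mul, Real.norm_eq_abs (c n), Real.norm_of_nonneg (by positivity),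
    Real.norm_of_nonneg (by positivity)]
  gcongr
  exact hc n

theorem hasDerivAt_tsum_rpow {c : ℕ → ℝ} {C q : ℝ} (hq0 : 0 < q) (hq1 : q < 1)
    (hc : ∀ n, |c n| ≤ C) (m : ℕ) {x : ℝ} (hx : 0 < x) :
    HasDerivAt (fun t : ℝ => ∑' n : ℕ, c n * ((n : ℝ) + 1) ^ m * (q ^ t) ^ (n + 1))
      (Real.log q * ∑' n : ℕ, c n * ((n : ℝ) + 1) ^ (m + 1) * (q ^ x) ^ (n + 1)) x := by
  have hy : 0 < x / 2 := by linarith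
  rw [← tsum_mul_left]
  refine hasDerivAt_tsum_of_isPreconnected (y₀ := x)
    (u := fun n : ℕ => |Real.log q| * (C * ((n : ℝ) + 1) ^ (m + 1) * (q ^ (x / 2)) ^ (n + 1)))
    (t := Set.Ioi (x / 2))
    (g' := fun (n : ℕ) (t : ℝ) =>
      Real.log q * (c n * ((n : ℝ) + 1) ^ (m + 1) * (q ^ t) ^ (n + 1)))
    ?_ isOpen_Ioi isPreconnected_Ioi ?_ ?_ ?_ ?_ ?_
  · exact (summable_succ_pow_mul_geometric (by positivity)
      (Real.rpow_lt_one hq0.le hq1 hy) (m + 1)).mul_left _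
  · intro n t _
    have h := ((Real.hasStrictDerivAt_const_rpow hq0 t).hasDerivAt.pow (n + 1)).const_mul
      (c n * ((n : ℝ) + 1) ^ m)
    refine h.congr_deriv ?_
    push_cast
    ring
  · intro n t ht
    rw [norm_mul, norm_mul, norm_mul, Real.norm_eq_abs (c n), Real.norm_eq_abs (Real.log q),
      Real.norm_of_nonneg (by positivity), Real.norm_of_nonneg (by positivity)]
    have hqt : q ^ t ≤ q ^ (x / 2) :=
      Real.rpow_le_rpow_of_exponent_ge hq0 hq1.le (Set.mem_Ioi.1 ht).le
    have hcn := hc n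
    have hC : 0 ≤ C := (abs_nonneg _).trans hcn
    gcongr
  · exact Set.mem_Ioi.2 (by linarith)
  · exact summable_coeff_mul_geometric hc (by positivity) (Real.rpow_lt_one hq0.le hq1 hx) m
  · exact Set.mem_Ioi.2 (by linarith)

theorem iteratedDeriv_succ_of_hasDerivAt_tsum_rpow {c : ℕ → ℝ} {C q : ℝ} {F : ℝ → ℝ}
    (hq0 : 0 < q) (hq1 : q < 1) (hc : ∀ n, |c n| ≤ C)
    (hF : ∀ x, 0 < x → HasDerivAt F (-∑' n : ℕ, c n * (q ^ x) ^ (n + 1)) x) (m : ℕ) :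
    ∀ x, 0 < x → iteratedDeriv (m + 1) F x =
      -(Real.log q ^ m * ∑' n : ℕ, c n * ((n : ℝ) + 1) ^ m * (q ^ x) ^ (n + 1)) := by
  induction m with
  | zero =>
    intro x hx
    simpa [iteratedDeriv_one] using (hF x hx).deriv
  | succ m ih =>
    intro x hx
    rw [iteratedDeriv_succ]
    have hev : iteratedDeriv (m + 1) F =ᶠ[nhds x] fun t =>
        -(Real.log q ^ m * ∑' n : ℕ, c n * ((n : ℝ) + 1) ^ m * (q ^ t) ^ (n + 1)) := by
      filter_upwards [Ioi_mem_nhds hx] with t ht using ih t ht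
    rw [hev.deriv_eq, ((hasDerivAt_tsum_rpow hq0 hq1 hc m hx).const_mul _).fun_neg.deriv]
    ring

theorem hasDerivAt_dilog {z : ℝ} (hz0 : 0 < z) (hz1 : z < 1) :
    HasDerivAt dilog (-(Real.log (1 - z) / z)) z := by
  have hmeas : Measurable fun t : ℝ => Real.log (1 - t) / t := by fun_prop
  refine (intervalIntegral.integral_hasDerivAt_right ?_
    hmeas.stronglyMeasurable.stronglyMeasurableAtFilter ?_).fun_neg
  · rw [intervalIntegrable_iff_integrableOn_Ioc_of_le hz0.le]
    refine MeasureTheory.IntegrableOn.of_bound (by simp)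
      hmeas.aestronglyMeasurable (1 / (1 - z)) ?_
    refine (MeasureTheory.ae_restrict_iff' measurableSet_Ioc).2 (Filter.Eventually.of_forall ?_)
    rintro t ⟨ht0, htz⟩
    have h1t : 0 < 1 - t := by linarith
    have h1z : 0 < 1 - z := by linarith
    have hlog : Real.log (1 - t) ≤ 0 := Real.log_nonpos h1t.le (by linarith)
    have hlow := Real.one_sub_inv_le_log_of_pos h1t
    have heq : 1 - (1 - t)⁻¹ = -(1 / (1 - t) * t) := by field_simp; ring
    rw [norm_div, Real.norm_of_nonpos hlog, Real.norm_of_nonneg ht0.le, div_le_iff₀ ht0]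
    calc -Real.log (1 - t) ≤ 1 / (1 - t) * t := by linarith
      _ ≤ 1 / (1 - z) * t := by gcongr
  · exact ((continuousAt_const.sub continuousAt_id).log (by simp; linarith)).div continuousAt_id
      hz0.ne'

theorem rpow_natCast_add_lt_one {q y : ℝ} (hq0 : 0 < q) (hq1 : q < 1) (hy : 0 < y) (j : ℕ) :
    q ^ ((j : ℝ) + y) < 1 :=
  Real.rpow_lt_one hq0.le hq1 (by positivity)

theorem qGamma_factor_pos {q y : ℝ} (hq0 : 0 < q) (hq1 : q < 1) (hy : 0 < y) (j : ℕ) :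
    0 < (1 - q ^ (j + 1)) / (1 - q ^ ((j : ℝ) + y)) :=
  div_pos (sub_pos.2 (pow_lt_one₀ hq0.le hq1 j.succ_ne_zero))
    (sub_pos.2 (rpow_natCast_add_lt_one hq0 hq1 hy j))

theorem hasDerivAt_log_qGamma_factor {q y : ℝ} (hq0 : 0 < q) (hq1 : q < 1) (hy : 0 < y) (j : ℕ) :
    HasDerivAt (fun t : ℝ => Real.log ((1 - q ^ (j + 1)) / (1 - q ^ ((j : ℝ) + t))))
      (Real.log q * (q ^ ((j : ℝ) + y) / (1 - q ^ ((j : ℝ) + y)))) y := by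
  have hden : 1 - q ^ ((j : ℝ) + y) ≠ 0 :=
    (sub_pos.2 (rpow_natCast_add_lt_one hq0 hq1 hy j)).ne'
  have hnum : 1 - q ^ (j + 1) ≠ 0 := (sub_pos.2 (pow_lt_one₀ hq0.le hq1 j.succ_ne_zero)).ne'
  have h := ((((Real.hasStrictDerivAt_const_rpow hq0 ((j : ℝ) + y)).hasDerivAt.comp_const_add (j : ℝ) y).const_sub
    1).log hden).const_sub (Real.log (1 - q ^ (j + 1)))
  have h' : HasDerivAt (fun t : ℝ => Real.log (1 - q ^ (j + 1)) - Real.log (1 - q ^ ((j : ℝ) + t)))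
      (Real.log q * (q ^ ((j : ℝ) + y) / (1 - q ^ ((j : ℝ) + y)))) y := by
    refine h.congr_deriv ?_
    ring
  refine h'.congr_of_eventuallyEq ?_
  filter_upwards [Ioi_mem_nhds hy] with t ht
  exact Real.log_div hnum (sub_pos.2 (rpow_natCast_add_lt_one hq0 hq1 ht j)).ne'

theorem rpow_div_one_sub_rpow_le {q y y₀ : ℝ} (hq0 : 0 < q) (hq1 : q < 1) (hy₀ : 0 < y₀)
    (hy : y₀ ≤ y) (j : ℕ) :
    q ^ ((j : ℝ) + y) / (1 - q ^ ((j : ℝ) + y)) ≤ q ^ j * (1 / (1 - q ^ y₀)) := by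
  have h1 : q ^ ((j : ℝ) + y) ≤ q ^ j := by
    rw [← Real.rpow_natCast]
    exact Real.rpow_le_rpow_of_exponent_ge hq0 hq1.le (by linarith)
  have h2 : q ^ ((j : ℝ) + y) ≤ q ^ y₀ :=
    Real.rpow_le_rpow_of_exponent_ge hq0 hq1.le (by linarith [j.cast_nonneg (α := ℝ)])
  have h3 : 0 < 1 - q ^ y₀ := sub_pos.2 (Real.rpow_lt_one hq0.le hq1 hy₀)
  rw [mul_one_div]
  gcongr

theorem qGamma_log_series_bounds {q y₀ : ℝ} (hq0 : 0 < q) (hq1 : q < 1) (hy₀ : 0 < y₀) :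
    (Summable fun j : ℕ => |Real.log q| * (q ^ j * (1 / (1 - q ^ y₀)))) ∧
    ∀ (j : ℕ), ∀ y ∈ Set.Ioi y₀,
      ‖Real.log q * (q ^ ((j : ℝ) + y) / (1 - q ^ ((j : ℝ) + y)))‖ ≤
        |Real.log q| * (q ^ j * (1 / (1 - q ^ y₀))) := by
  refine ⟨((summable_geometric_of_lt_one hq0.le hq1).mul_right _).mul_left _, fun j y hy => ?_⟩
  have hy0 : 0 < y := hy₀.trans hy
  have h := sub_pos.2 (rpow_natCast_add_lt_one hq0 hq1 hy0 j)
  rw [norm_mul, Real.norm_eq_abs (Real.log q), Real.norm_of_nonneg (by positivity)]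
  gcongr
  exact rpow_div_one_sub_rpow_le hq0 hq1 hy₀ (le_of_lt hy) j

theorem qGamma_log_series {q y : ℝ} (hq0 : 0 < q) (hq1 : q < 1) (hy : 0 < y) :
    (Summable fun j : ℕ => Real.log ((1 - q ^ (j + 1)) / (1 - q ^ ((j : ℝ) + y)))) ∧
    HasDerivAt (fun t : ℝ => ∑' j : ℕ, Real.log ((1 - q ^ (j + 1)) / (1 - q ^ ((j : ℝ) + t))))
      (Real.log q * ∑' j : ℕ, q ^ ((j : ℝ) + y) / (1 - q ^ ((j : ℝ) + y))) y := by
  have hy₀ : 0 < min y 1 / 2 := by positivity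
  have hlt : min y 1 / 2 < min y 1 := by linarith
  obtain ⟨hu, hb⟩ := qGamma_log_series_bounds hq0 hq1 hy₀
  have hd : ∀ (j : ℕ), ∀ t ∈ Set.Ioi (min y 1 / 2), HasDerivAt
      (fun t : ℝ => Real.log ((1 - q ^ (j + 1)) / (1 - q ^ ((j : ℝ) + t))))
      (Real.log q * (q ^ ((j : ℝ) + t) / (1 - q ^ ((j : ℝ) + t)))) t :=
    fun j t ht => hasDerivAt_log_qGamma_factor hq0 hq1 (hy₀.trans ht) j
  have h1mem : (1 : ℝ) ∈ Set.Ioi (min y 1 / 2) := hlt.trans_le (min_le_right _ _)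
  have hymem : y ∈ Set.Ioi (min y 1 / 2) := hlt.trans_le (min_le_left _ _)
  have h1 : Summable fun j : ℕ =>
      Real.log ((1 - q ^ (j + 1)) / (1 - q ^ ((j : ℝ) + 1))) := by
    refine summable_zero.congr fun j => ?_
    have h := qGamma_factor_pos hq0 hq1 one_pos j
    have hcast : q ^ ((j : ℝ) + 1) = q ^ (j + 1) := by exact_mod_cast Real.rpow_natCast q (j + 1)
    rw [hcast] at h ⊢
    rw [div_self fun h0 => by simp [h0] at h, Real.log_one]
  refine ⟨summable_of_summable_hasDerivAt_of_isPreconnected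
    (g := fun (j : ℕ) (t : ℝ) => Real.log ((1 - q ^ (j + 1)) / (1 - q ^ ((j : ℝ) + t))))
    (g' := fun (j : ℕ) (t : ℝ) =>
      Real.log q * (q ^ ((j : ℝ) + t) / (1 - q ^ ((j : ℝ) + t))))
    hu isOpen_Ioi isPreconnected_Ioi hd hb h1mem h1 hymem, ?_⟩
  rw [← tsum_mul_left]
  exact hasDerivAt_tsum_of_isPreconnected
    (g := fun (j : ℕ) (t : ℝ) => Real.log ((1 - q ^ (j + 1)) / (1 - q ^ ((j : ℝ) + t))))
    (g' := fun (j : ℕ) (t : ℝ) =>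
      Real.log q * (q ^ ((j : ℝ) + t) / (1 - q ^ ((j : ℝ) + t))))
    hu isOpen_Ioi isPreconnected_Ioi hd hb h1mem h1 hymem

theorem qGamma_pos {q y : ℝ} (hq0 : 0 < q) (hq1 : q < 1) (hy : 0 < y) : 0 < qGamma q y := by
  rw [qGamma, ← Real.rexp_tsum_eq_tprod (fun j => qGamma_factor_pos hq0 hq1 hy j)
    (qGamma_log_series hq0 hq1 hy).1]
  have : 0 < 1 - q := sub_pos.2 hq1
  positivity

theorem log_qGamma {q y : ℝ} (hq0 : 0 < q) (hq1 : q < 1) (hy : 0 < y) :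
    Real.log (qGamma q y) = (1 - y) * Real.log (1 - q) +
      ∑' j : ℕ, Real.log ((1 - q ^ (j + 1)) / (1 - q ^ ((j : ℝ) + y))) := by
  have h : 0 < 1 - q := sub_pos.2 hq1
  rw [qGamma, ← Real.rexp_tsum_eq_tprod (fun j => qGamma_factor_pos hq0 hq1 hy j)
    (qGamma_log_series hq0 hq1 hy).1, Real.log_mul (by positivity) (by positivity), Real.log_exp,
    Real.log_rpow h]

theorem hasDerivAt_log_qGamma {q y : ℝ} (hq0 : 0 < q) (hq1 : q < 1) (hy : 0 < y) :
    HasDerivAt (fun t => Real.log (qGamma q t)) (-Real.log (1 - q) +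
      Real.log q * ∑' j : ℕ, q ^ ((j : ℝ) + y) / (1 - q ^ ((j : ℝ) + y))) y := by
  have h := (((hasDerivAt_id y).const_sub 1).mul_const (Real.log (1 - q))).add
    (qGamma_log_series hq0 hq1 hy).2
  rw [neg_one_mul] at h
  refine h.congr_of_eventuallyEq ?_
  filter_upwards [Ioi_mem_nhds hy] with t ht using log_qGamma hq0 hq1 ht

theorem hasSum_pow_succ {z : ℝ} (hz0 : 0 ≤ z) (hz1 : z < 1) :
    HasSum (fun n : ℕ => z ^ (n + 1)) (z / (1 - z)) := by
  simpa only [pow_succ', div_eq_mul_inv] using (hasSum_geometric_of_lt_one hz0 hz1).mul_left z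

theorem tsum_rpow_div_one_sub_rpow {q y : ℝ} (hq0 : 0 < q) (hq1 : q < 1) (hy : 0 < y) :
    ∑' j : ℕ, q ^ ((j : ℝ) + y) / (1 - q ^ ((j : ℝ) + y)) =
      ∑' n : ℕ, (q ^ y) ^ (n + 1) / (1 - q ^ (n + 1)) := by
  have hin : ∀ j : ℕ, HasSum (fun n : ℕ => (q ^ ((j : ℝ) + y)) ^ (n + 1))
      (q ^ ((j : ℝ) + y) / (1 - q ^ ((j : ℝ) + y))) := fun j =>
    hasSum_pow_succ (by positivity) (rpow_natCast_add_lt_one hq0 hq1 hy j)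
  have hs : Summable (Function.uncurry fun (j n : ℕ) => (q ^ ((j : ℝ) + y)) ^ (n + 1)) := by
    refine (summable_prod_of_nonneg fun p => ?_).2 ⟨fun j => (hin j).summable, ?_⟩
    · simp only [Function.uncurry, Pi.zero_apply]
      positivity
    · simp only [Function.uncurry, (hin _).tsum_eq]
      refine Summable.of_nonneg_of_le (fun j => ?_)
        (fun j => rpow_div_one_sub_rpow_le hq0 hq1 hy le_rfl j)
        ((summable_geometric_of_lt_one hq0.le hq1).mul_right _)
      have := sub_pos.2 (rpow_natCast_add_lt_one hq0 hq1 hy j)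
      positivity
  rw [← tsum_congr fun j => (hin j).tsum_eq, ← hs.tsum_comm]
  refine tsum_congr fun n => ?_
  have hg := hasSum_geometric_of_lt_one (pow_nonneg hq0.le (n + 1))
    (pow_lt_one₀ hq0.le hq1 n.succ_ne_zero)
  rw [div_eq_mul_inv, ← (hg.mul_left ((q ^ y) ^ (n + 1))).tsum_eq]
  refine tsum_congr fun j => ?_
  rw [Real.rpow_add hq0, Real.rpow_natCast, mul_pow, ← pow_mul, ← pow_mul, mul_comm j, mul_comm]

/-- The coefficients of `-(log f_{α,β})'(x)` as a power series in `q ^ x`. -/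
noncomputable def qfCoeff (α β q : ℝ) (n : ℕ) : ℝ :=
  -Real.log q * ((q ^ β) ^ (n + 1) / (1 - q ^ (n + 1))) - 1 / ((n : ℝ) + 1) +
    (β - α) * -Real.log q

theorem qfCoeff_nonneg {α β q : ℝ} (hq0 : 0 < q) (hq1 : q < 1) (hα : 2 * α ≤ 1) (hβ : 1 ≤ β)
    (n : ℕ) : 0 ≤ qfCoeff α β q n := by
  have hL : 0 < -Real.log q := by linarith [Real.log_neg hq0 hq1]
  have hn : (0 : ℝ) < (n : ℝ) + 1 := by positivity
  have h := one_le_mul_exp_div_add (mul_pos hn hL) hα hβ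
  have e1 : Real.exp (-(((n : ℝ) + 1) * -Real.log q)) = q ^ (n + 1) := by
    rw [← Real.rpow_natCast, Real.rpow_def_of_pos hq0]
    push_cast
    ring_nf
  have e2 : Real.exp (-(β * (((n : ℝ) + 1) * -Real.log q))) = (q ^ β) ^ (n + 1) := by
    rw [← Real.rpow_natCast, ← Real.rpow_mul hq0.le, Real.rpow_def_of_pos hq0]
    push_cast
    ring_nf
  rw [e1, e2] at h
  have heq : qfCoeff α β q n = (((n : ℝ) + 1) * -Real.log q * (q ^ β) ^ (n + 1) /
      (1 - q ^ (n + 1)) + (β - α) * (((n : ℝ) + 1) * -Real.log q) - 1) / ((n : ℝ) + 1) := by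
    rw [qfCoeff]
    field_simp
    ring
  rw [heq]
  exact div_nonneg (by linarith) hn.le

theorem abs_qfCoeff_le {α β q : ℝ} (hq0 : 0 < q) (hq1 : q < 1) (hα : 2 * α ≤ 1) (hβ : 1 ≤ β)
    (n : ℕ) : |qfCoeff α β q n| ≤
      -Real.log q * (1 / (1 - q)) + (β - α) * -Real.log q := by
  rw [abs_of_nonneg (qfCoeff_nonneg hq0 hq1 hα hβ n), qfCoeff]
  have hL : 0 < -Real.log q := by linarith [Real.log_neg hq0 hq1]
  have h1 : (q ^ β) ^ (n + 1) / (1 - q ^ (n + 1)) ≤ 1 / (1 - q) := by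
    have h2 : (q ^ β) ^ (n + 1) ≤ 1 :=
      pow_le_one₀ (by positivity) (Real.rpow_le_one hq0.le hq1.le (by linarith))
    have h3 : q ^ (n + 1) ≤ q := pow_le_of_le_one hq0.le hq1.le n.succ_ne_zero
    have h4 : 0 < 1 - q := sub_pos.2 hq1
    gcongr
  have h2 := mul_le_mul_of_nonneg_left h1 hL.le
  have h3 : 0 ≤ 1 / ((n : ℝ) + 1) := by positivity
  linarith

theorem log_qf {α β q x : ℝ} (hq0 : 0 < q) (hq1 : q < 1) (hβ : 0 ≤ β) (hx : 0 < x) :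
    Real.log (qf α β q x) = Real.log (qGamma q (x + β)) + -dilog (1 - q ^ x) / Real.log q -
      (x + β - α) * (Real.log (1 - q ^ x) - Real.log (1 - q)) := by
  have h1 : 0 < 1 - q := sub_pos.2 hq1
  have h2 : 0 < 1 - q ^ x := sub_pos.2 (Real.rpow_lt_one hq0.le hq1 hx)
  have h3 : 0 < qGamma q (x + β) := qGamma_pos hq0 hq1 (by linarith)
  rw [qf, Real.log_div (by positivity) (by positivity), Real.log_mul h3.ne' (Real.exp_ne_zero _),
    Real.log_exp, Real.log_rpow (by positivity), Real.log_div h2.ne' h1.ne']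

theorem hasDerivAt_log_qf {α β q x : ℝ} (hq0 : 0 < q) (hq1 : q < 1) (hβ : 0 ≤ β) (hx : 0 < x) :
    HasDerivAt (fun t => Real.log (qf α β q t))
      (-∑' n : ℕ, qfCoeff α β q n * (q ^ x) ^ (n + 1)) x := by
  have hz0 : 0 < q ^ x := by positivity
  have hz1 : q ^ x < 1 := Real.rpow_lt_one hq0.le hq1 hx
  have h1z : 0 < 1 - q ^ x := sub_pos.2 hz1
  have hL : Real.log q ≠ 0 := (Real.log_neg hq0 hq1).ne
  have hxβ : 0 < x + β := by linarith
  have hz := (Real.hasStrictDerivAt_const_rpow hq0 x).hasDerivAt.const_sub 1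
  have hΓ := (hasDerivAt_log_qGamma hq0 hq1 hxβ).comp_add_const x β
  have hLi := ((hasDerivAt_dilog h1z (by linarith)).comp x hz).fun_neg.div_const (Real.log q)
  have hlog := (((hasDerivAt_id x).add_const β).sub_const α).fun_mul
    ((hz.log h1z.ne').sub_const (Real.log (1 - q)))
  have hsumG : Summable fun n : ℕ => (q ^ (x + β)) ^ (n + 1) / (1 - q ^ (n + 1)) := by
    refine Summable.of_nonneg_of_le (fun n => ?_) (fun n => ?_)
      ((hasSum_pow_succ (z := q ^ (x + β)) (by positivity)
        (Real.rpow_lt_one hq0.le hq1 hxβ)).summable.mul_right (1 / (1 - q)))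
    · have := sub_pos.2 (pow_lt_one₀ hq0.le hq1 n.succ_ne_zero)
      positivity
    · have h3 : q ^ (n + 1) ≤ q := pow_le_of_le_one hq0.le hq1.le n.succ_ne_zero
      have h4 : 0 < 1 - q := sub_pos.2 hq1
      rw [mul_one_div]
      gcongr
  have hsum : HasSum (fun n : ℕ => qfCoeff α β q n * (q ^ x) ^ (n + 1))
      (-Real.log q * (∑' n : ℕ, (q ^ (x + β)) ^ (n + 1) / (1 - q ^ (n + 1))) -
        -Real.log (1 - q ^ x) + (β - α) * -Real.log q * (q ^ x / (1 - q ^ x))) := by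
    have h := ((hsumG.hasSum.mul_left (-Real.log q)).sub
      (Real.hasSum_pow_div_log_of_abs_lt_one (by rwa [abs_of_pos hz0]))).add
      ((hasSum_pow_succ hz0.le hz1).mul_left ((β - α) * -Real.log q))
    refine h.congr_fun fun n => ?_
    rw [qfCoeff, Real.rpow_add hq0, mul_pow]
    ring
  have h := (hΓ.fun_add hLi).fun_sub hlog
  rw [hsum.tsum_eq]
  refine HasDerivAt.congr_of_eventuallyEq (f := fun t => Real.log (qGamma q (t + β)) +
    -dilog (1 - q ^ t) / Real.log q -
      (t + β - α) * (Real.log (1 - q ^ t) - Real.log (1 - q))) ?_ ?_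
  · refine h.congr_deriv ?_
    rw [tsum_rpow_div_one_sub_rpow hq0 hq1 hxβ, sub_sub_cancel, Real.log_rpow hq0]
    simp only [id]
    field_simp
    ring
  · filter_upwards [Ioi_mem_nhds hx] with t ht using log_qf hq0 hq1 hβ ht

/-- If `0 < q < 1` and `2α ≤ 1 ≤ β`, then `f_{α,β}(·;q)` is logarithmically completely
monotonic on `(0,∞)`: for every `n ≥ 1` and `x > 0`,
`(−1)^n (log f_{α,β}(·;q))^{(n)}(x) ≥ 0`. -/
theorem logCompletelyMonotonic_qf_general
    (q α β : ℝ) (hq0 : 0 < q) (hq1 : q < 1) (hα : 2 * α ≤ 1) (hβ : 1 ≤ β) :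
    ∀ n : ℕ, 1 ≤ n → ∀ x : ℝ, 0 < x →
      0 ≤ (-1 : ℝ) ^ n * iteratedDeriv n (fun t => Real.log (qf α β q t)) x := by
  intro n hn x hx
  obtain ⟨m, rfl⟩ : ∃ m, n = m + 1 := ⟨n - 1, by omega⟩
  rw [iteratedDeriv_succ_of_hasDerivAt_tsum_rpow hq0 hq1 (abs_qfCoeff_le hq0 hq1 hα hβ)
    (fun y hy => hasDerivAt_log_qf hq0 hq1 (by linarith) hy) m x hx]
  have hS : 0 ≤ ∑' k : ℕ, qfCoeff α β q k * ((k : ℝ) + 1) ^ m * (q ^ x) ^ (k + 1) :=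
    tsum_nonneg fun k => by
      have := qfCoeff_nonneg hq0 hq1 hα hβ k
      positivity
  have hL : 0 ≤ (-Real.log q) ^ m := pow_nonneg (by linarith [Real.log_neg hq0 hq1]) m
  calc (0 : ℝ) ≤ (-Real.log q) ^ m *
        ∑' k : ℕ, qfCoeff α β q k * ((k : ℝ) + 1) ^ m * (q ^ x) ^ (k + 1) := mul_nonneg hL hS
    _ = _ := by rw [neg_pow (Real.log q)]; ring
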